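/- arXiv:2009.13978 — 2 statements merged into one kernel-verified Lean document; each statement's English description precedes it below -/
import Mathlib

section
/- Decisional equivalence in the unverifiability reduction (core of Theorem 2): let P ∈ G1, a, b, c, r, h ∈ ZMod q with h ≠ 0, and ω ∈ G2. Set P_pub = c•P, Q_S = a•P, S_V = b•P_pub, U' = r•P, and σ = e(b•P, c•P)^r · ω^h. Then σ = e(U' + h•Q_S, S_V) if and only if ω = e(P, P)^(a·b·c). -/
/-- In a group of exponent dividing `q`, iterated powers by residues mod `q` multiply. -/
theorem pow_val_pow_val {q : ℕ} {G : Type*} [Monoid G] {g : G} (hg : g ^ q = 1)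
    (x y : ZMod q) : (g ^ x.val) ^ y.val = g ^ (x * y).val := by
  rw [← pow_mul, ZMod.val_mul, ← pow_eq_pow_mod _ hg]

/-- A map turning sums into products turns scalar multiples by residues into powers. -/
theorem map_smul_eq_pow_val {q : ℕ} [NeZero q] {A G : Type*} [AddCommGroup A]
    [Module (ZMod q) A] [Group G] (f : A → G) (hf : ∀ x y, f (x + y) = f x * f y)
    (x : ZMod q) (v : A) : f (x • v) = f v ^ x.val := by
  have hnsmul (n : ℕ) : f (n • v) = f v ^ n := by
    induction n with
    | zero => simpa using hf 0 0
    | succ n ih => rw [succ_nsmul, hf, ih, pow_succ]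
  rw [← hnsmul, ← Nat.cast_smul_eq_nsmul (ZMod q), ZMod.natCast_zmod_val]

/-- Raising to a nonzero residue is injective in a group of prime exponent. -/
theorem pow_val_injective {q : ℕ} [Fact q.Prime] {G : Type*} [Monoid G]
    (hexp : ∀ g : G, g ^ q = 1) {h : ZMod q} (hh : h ≠ 0) :
    Function.Injective fun g : G => g ^ h.val :=
  Function.LeftInverse.injective (g := fun g => g ^ (h⁻¹).val) fun g => by
    have : Fact (1 < q) := ⟨(Fact.out : q.Prime).one_lt⟩
    simp only [pow_val_pow_val (hexp g), mul_inv_cancel₀ hh, ZMod.val_one, pow_one]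

/-- Decisional equivalence in the unverifiability reduction: with `P_pub = c • P`,
`Q_S = a • P`, `S_V = b • P_pub`, `U' = r • P`, `h ≠ 0`, and
`σ = e(b • P, c • P)^r · ω^h`, the verification equation
`σ = e(U' + h • Q_S, S_V)` holds if and only if `ω = e(P,P)^(a*b*c)`. -/
theorem dbdhp_decision (q : ℕ) [Fact q.Prime]
    (G1 : Type*) [AddCommGroup G1] [Module (ZMod q) G1]
    (G2 : Type*) [CommGroup G2]
    (hexp : ∀ g : G2, g ^ q = 1)
    (e : G1 → G1 → G2)
    (he_left : ∀ A B C : G1, e (A + B) C = e A C * e B C)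
    (he_right : ∀ A B C : G1, e A (B + C) = e A B * e A C)
    (P : G1) (a b c r h : ZMod q) (hh : h ≠ 0) (ω : G2)
    (Ppub QS SV U' : G1) (σ : G2)
    (hPpub : Ppub = c • P)
    (hQS : QS = a • P)
    (hSV : SV = b • Ppub)
    (hU' : U' = r • P)
    (hσ : σ = (e (b • P) (c • P)) ^ r.val * ω ^ h.val) :
    σ = e (U' + h • QS) SV ↔ ω = (e P P) ^ (a * b * c).val := by
  have hl (x : ZMod q) (A B : G1) : e (x • A) B = e A B ^ x.val :=
    map_smul_eq_pow_val (fun A => e A B) (fun A A' => he_left A A' B) x A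
  have hr (x : ZMod q) (A B : G1) : e A (x • B) = e A B ^ x.val :=
    map_smul_eq_pow_val (e A) (he_right A) x B
  subst hPpub hQS hSV hU' hσ
  simp only [he_left, hl, hr, pow_val_pow_val (hexp (e P P))]
  rw [mul_right_inj, show c * b * a * h = a * b * c * h by ring,
    ← pow_val_pow_val (hexp (e P P))]
  exact (pow_val_injective hexp hh).eq_iff
end

section
/- Non-transferability (core of Theorem 3): the designated verifier's transcript simulation with the same randomness produces exactly the same signature as the signer. Precisely, let s, r, x, y, h ∈ ZMod q with x ≠ 0, and Q_S, Q_V ∈ G1; set S_S = s•Q_S, S_V = s•Q_V, U = r•Q_S, U' = x•U + (x·y)•Q_S, h₁ = x⁻¹·h + y, and define the signer's output σ = e(x•((r + h₁)•S_S), Q_V) and the simulator's output σ̂ = e(x•((r + h₁)•Q_S), S_V). Then σ = σ̂, so the pairs (U', σ) and (U', σ̂) are identical. -/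
theorem map_nsmul_eq_pow_of_map_add {A G : Type*} [AddMonoid A] [Group G] {f : A → G}
    (hf : ∀ a b, f (a + b) = f a * f b) (n : ℕ) (a : A) : f (n • a) = f a ^ n :=
  map_nsmul (AddMonoidHom.mk' (G := Additive G) f hf) n a

theorem pairing_smul_comm {q : ℕ} [NeZero q] {G₁ G₂ : Type*} [AddCommGroup G₁]
    [Module (ZMod q) G₁] [Group G₂] {e : G₁ → G₁ → G₂}
    (he_left : ∀ A B C, e (A + B) C = e A C * e B C)
    (he_right : ∀ A B C, e A (B + C) = e A B * e A C) (s : ZMod q) (A B : G₁) :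
    e (s • A) B = e A (s • B) := by
  rw [← ZMod.natCast_zmod_val s, Nat.cast_smul_eq_nsmul, Nat.cast_smul_eq_nsmul,
    map_nsmul_eq_pow_of_map_add (f := fun A ↦ e A B) (fun A C ↦ he_left A C B),
    map_nsmul_eq_pow_of_map_add (he_right A)]

/-- Non-transferability (core): the designated verifier's transcript simulation with
the same randomness produces exactly the same signature as the signer:
`e(x • ((r + h₁) • S_S), Q_V) = e(x • ((r + h₁) • Q_S), S_V)`. -/
theorem non_transferability (q : ℕ) [Fact q.Prime]
    (G1 : Type*) [AddCommGroup G1] [Module (ZMod q) G1]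
    (G2 : Type*) [CommGroup G2]
    (hexp : ∀ g : G2, g ^ q = 1)
    (e : G1 → G1 → G2)
    (he_left : ∀ A B C : G1, e (A + B) C = e A C * e B C)
    (he_right : ∀ A B C : G1, e A (B + C) = e A B * e A C)
    (s r x y h : ZMod q) (hx : x ≠ 0) (QS QV : G1)
    (SS SV U U' : G1) (h₁ : ZMod q) (σ σhat : G2)
    (hSS : SS = s • QS) (hSV : SV = s • QV)
    (hU : U = r • QS)
    (hU' : U' = x • U + (x * y) • QS)
    (hh₁ : h₁ = x⁻¹ * h + y)
    (hσ : σ = e (x • ((r + h₁) • SS)) QV)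
    (hσhat : σhat = e (x • ((r + h₁) • QS)) SV) :
    σ = σhat := by
  rw [hσ, hσhat, hSS, hSV, smul_comm (r + h₁) s QS, smul_comm x s]
  exact pairing_smul_comm he_left he_right s _ QV
end
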